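/- Let g : ℝ^(n0+n1) → Sym⁺_d(ℝ) be a C² N-log-concave function. Fix x ∈ ℝ^(n0+n1), define the block operators Θ^g_{0,0}, Θ^g_{1,1}, Θ^g_{0,1} as above, and assume Θ^g_{1,1} is invertible as an operator on M_{d,n1}(ℝ). Then for every V₀ ∈ M_{d,n0}(ℝ): ⟨−Θ^g_{0,0} V₀, V₀⟩_{id_{n0}⊗g(x)} ≥ ⟨(−Θ^g_{1,1})⁻¹ Θ^g_{0,1} V₀, Θ^g_{0,1} V₀⟩_{id_{n1}⊗g(x)}. -/

import Mathlib

open Matrix MeasureTheory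

noncomputable section

/-- Entrywise partial derivative, in direction `x_j`, of a matrix-valued function. -/
def mpd {n d : ℕ} (j : Fin n) (g : (Fin n → ℝ) → Matrix (Fin d) (Fin d) ℝ)
    (x : Fin n → ℝ) : Matrix (Fin d) (Fin d) ℝ :=
  Matrix.of fun i k => fderiv ℝ (fun y => g y i k) x (Pi.single j 1)

/-- `θ^g_{j,k}(x) = g(x)⁻¹ (∂²_{x_k x_j} g(x) − (∂_{x_k} g)(x) g(x)⁻¹ (∂_{x_j} g)(x))`. -/
def theta {n d : ℕ} (g : (Fin n → ℝ) → Matrix (Fin d) (Fin d) ℝ) (j k : Fin n)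
    (x : Fin n → ℝ) : Matrix (Fin d) (Fin d) ℝ :=
  (g x)⁻¹ * (mpd k (mpd j g) x - mpd k g x * (g x)⁻¹ * mpd j g x)

/-- The operator `Θ^g(x)` on `M_{d,n}(ℝ)`: a `d×n` matrix is encoded by its columns
`U : Fin n → Fin d → ℝ`, and the `k`-th column of `Θ^g(x) U` is `Σ_j θ^g_{j,k}(x) u_j`. -/
def ThetaOp {n d : ℕ} (g : (Fin n → ℝ) → Matrix (Fin d) (Fin d) ℝ)
    (x : Fin n → ℝ) (U : Fin n → Fin d → ℝ) : Fin n → Fin d → ℝ :=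
  fun k => ∑ j, (theta g j k x).mulVec (U j)

/-- `⟨U,V⟩_{id_n ⊗ a} = Σ_k ⟨a u_k, v_k⟩` on `M_{d,n}(ℝ)` (matrices given by columns). -/
def minner {n d : ℕ} (a : Matrix (Fin d) (Fin d) ℝ)
    (U V : Fin n → Fin d → ℝ) : ℝ :=
  ∑ k, a.mulVec (U k) ⬝ᵥ V k

/-- `‖u‖²_a = ⟨a u, u⟩` on `ℝ^d`. -/
def vnormSq {d : ℕ} (a : Matrix (Fin d) (Fin d) ℝ) (u : Fin d → ℝ) : ℝ :=
  a.mulVec u ⬝ᵥ u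

/-- N-log-concavity: `⟨Θ^g(x) U, U⟩_{id_n ⊗ g(x)} ≤ 0` for all `x` and `U`. -/
def NLogConcave {n d : ℕ} (g : (Fin n → ℝ) → Matrix (Fin d) (Fin d) ℝ) : Prop :=
  ∀ (x : Fin n → ℝ) (U : Fin n → Fin d → ℝ), minner (g x) (ThetaOp g x U) U ≤ 0

/-- Entrywise `C^k` smoothness of a matrix-valued function. -/
def MatCD {n d : ℕ} (k : ℕ) (g : (Fin n → ℝ) → Matrix (Fin d) (Fin d) ℝ) : Prop :=
  ∀ i j, ContDiff ℝ k fun y => g y i j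

/-- Polar of a nonnegative quadratic form `Q` with respect to a bilinear pairing `inn`:
`Q°(v) = sup { ⟨u,v⟩² : Q(u) ≤ 1 }`. -/
def polar {E : Type*} (inn : E → E → ℝ) (Q : E → ℝ) (v : E) : ℝ :=
  sSup {r | ∃ u, Q u ≤ 1 ∧ r = inn u v ^ 2}

/-- Partial derivative `∂_{x_j} F` of a vector-valued function. -/
def pdF {n d : ℕ} (j : Fin n) (F : (Fin n → ℝ) → Fin d → ℝ) (x : Fin n → ℝ) : Fin d → ℝ :=
  fun i => fderiv ℝ (fun y => F y i) x (Pi.single j 1)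

/-- `∇_x F = [∂_{x_1} F, …, ∂_{x_n} F] ∈ M_{d,n}(ℝ)`, encoded by columns. -/
def gradM {n d : ℕ} (F : (Fin n → ℝ) → Fin d → ℝ) (x : Fin n → ℝ) :
    Fin n → Fin d → ℝ :=
  fun j => pdF j F x

/-- The operator `L F = Δ F + Σ_k (g⁻¹ ∂_{x_k} g) ∂_{x_k} F`. -/
def Lop {n d : ℕ} (g : (Fin n → ℝ) → Matrix (Fin d) (Fin d) ℝ)
    (F : (Fin n → ℝ) → Fin d → ℝ) (x : Fin n → ℝ) : Fin d → ℝ :=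
  (∑ k, pdF k (pdF k F) x) + ∑ k, ((g x)⁻¹ * mpd k g x).mulVec (pdF k F x)

/-- `Θ^g(x)` realized as a `dn × dn` matrix acting on `ℝ^{n×d} ≅ M_{d,n}(ℝ)`. -/
def ThetaMat {n d : ℕ} (g : (Fin n → ℝ) → Matrix (Fin d) (Fin d) ℝ)
    (x : Fin n → ℝ) : Matrix (Fin n × Fin d) (Fin n × Fin d) ℝ :=
  Matrix.of fun p q => theta g q.1 p.1 x p.2 q.2

/-- Identification `M_{d,n}(ℝ) → ℝ^{n×d}`. -/
def toVec {n d : ℕ} (U : Fin n → Fin d → ℝ) : Fin n × Fin d → ℝ := fun p => U p.1 p.2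

/-- Identification `ℝ^{n×d} → M_{d,n}(ℝ)`. -/
def ofVec {n d : ℕ} (v : Fin n × Fin d → ℝ) : Fin n → Fin d → ℝ := fun k i => v (k, i)

/-- The block `Θ^g_{0,0}` on `M_{d,n0}(ℝ)`. -/
def Theta00 {n0 n1 d : ℕ} (g : (Fin (n0 + n1) → ℝ) → Matrix (Fin d) (Fin d) ℝ)
    (x : Fin (n0 + n1) → ℝ) (V : Fin n0 → Fin d → ℝ) : Fin n0 → Fin d → ℝ :=
  fun k => ∑ j, (theta g (Fin.castAdd n1 j) (Fin.castAdd n1 k) x).mulVec (V j)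

/-- The mixed block `Θ^g_{0,1} : M_{d,n0}(ℝ) → M_{d,n1}(ℝ)`. -/
def Theta01 {n0 n1 d : ℕ} (g : (Fin (n0 + n1) → ℝ) → Matrix (Fin d) (Fin d) ℝ)
    (x : Fin (n0 + n1) → ℝ) (V : Fin n0 → Fin d → ℝ) : Fin n1 → Fin d → ℝ :=
  fun k => ∑ j, (theta g (Fin.castAdd n1 j) (Fin.natAdd n0 k) x).mulVec (V j)

/-- The block `Θ^g_{1,1}` on `M_{d,n1}(ℝ)`. -/
def Theta11 {n0 n1 d : ℕ} (g : (Fin (n0 + n1) → ℝ) → Matrix (Fin d) (Fin d) ℝ)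
    (x : Fin (n0 + n1) → ℝ) (W : Fin n1 → Fin d → ℝ) : Fin n1 → Fin d → ℝ :=
  fun k => ∑ j, (theta g (Fin.natAdd n0 j) (Fin.natAdd n0 k) x).mulVec (W j)

/-- The block `Θ^g_{1,1}` realized as a `d n1 × d n1` matrix. -/
def Theta11Mat {n0 n1 d : ℕ} (g : (Fin (n0 + n1) → ℝ) → Matrix (Fin d) (Fin d) ℝ)
    (x : Fin (n0 + n1) → ℝ) : Matrix (Fin n1 × Fin d) (Fin n1 × Fin d) ℝ :=
  Matrix.of fun p q => theta g (Fin.natAdd n0 q.1) (Fin.natAdd n0 p.1) x p.2 q.2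

/-- The `dn × dn` matrix `Θ̃^g(x)` with `(j,k)` block `g(x) θ^g_{j,k}(x)`. -/
def tThetaMat {n d : ℕ} (g : (Fin n → ℝ) → Matrix (Fin d) (Fin d) ℝ)
    (x : Fin n → ℝ) : Matrix (Fin n × Fin d) (Fin n × Fin d) ℝ :=
  Matrix.of fun p q => (g x * theta g q.1 p.1 x) p.2 q.2

/-- Hessian matrix of a scalar function on `ℝⁿ`. -/
def Hess {n : ℕ} (φ : (Fin n → ℝ) → ℝ) (y : Fin n → ℝ) : Matrix (Fin n) (Fin n) ℝ :=
  Matrix.of fun j k => fderiv ℝ (fun z => fderiv ℝ φ z (Pi.single k 1)) y (Pi.single j 1)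

/-- Gradient of a scalar function on `ℝⁿ`. -/
def gradV {n : ℕ} (u : (Fin n → ℝ) → ℝ) (y : Fin n → ℝ) : Fin n → ℝ :=
  fun j => fderiv ℝ u y (Pi.single j 1)

theorem mpd_transpose {n d : ℕ} {g : (Fin n → ℝ) → Matrix (Fin d) (Fin d) ℝ}
    (hsymm : ∀ y, (g y)ᵀ = g y) (j : Fin n) (x : Fin n → ℝ) : (mpd j g x)ᵀ = mpd j g x := by
  ext a b
  have h : (fun y => g y b a) = fun y => g y a b :=
    funext fun y => congrFun (congrFun (hsymm y) a) b
  simp only [mpd, transpose_apply, of_apply, h]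

theorem mpd_comm {n d : ℕ} {g : (Fin n → ℝ) → Matrix (Fin d) (Fin d) ℝ}
    (hg : MatCD 2 g) (j k : Fin n) (x : Fin n → ℝ) :
    mpd k (mpd j g) x = mpd j (mpd k g) x := by
  ext a b
  have hab : ContDiff ℝ 2 fun y => g y a b := by exact_mod_cast hg a b
  have hdiff : DifferentiableAt ℝ (fderiv ℝ fun y => g y a b) x :=
    (hab.fderiv_right (m := 1) (by norm_num)).differentiable (by norm_num) x
  have hsnd : ∀ v w : Fin n → ℝ, fderiv ℝ (fun y => fderiv ℝ (fun z => g z a b) y v) x w =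
      fderiv ℝ (fderiv ℝ fun y => g y a b) x w v := fun v w => by
    rw [fderiv_clm_apply hdiff (differentiableAt_const v)]
    simp
  have hsymm : IsSymmSndFDerivAt ℝ (fun y => g y a b) x :=
    hab.contDiffAt.isSymmSndFDerivAt (by simp)
  simp only [mpd, of_apply, hsnd]
  exact hsymm _ _

/-- The matrices `g θ^g_{j,k}` and `g θ^g_{k,j}` are transposes of one another. -/
theorem transpose_mul_theta {n d : ℕ} {g : (Fin n → ℝ) → Matrix (Fin d) (Fin d) ℝ}
    (hg : MatCD 2 g) (hgpos : ∀ y, (g y).PosDef) (j k : Fin n) (x : Fin n → ℝ) :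
    (g x * theta g j k x)ᵀ = g x * theta g k j x := by
  have hsymm : ∀ y, (g y)ᵀ = g y := fun y => by
    simpa [conjTranspose_eq_transpose_of_trivial] using (hgpos y).isHermitian.eq
  have hdet : IsUnit (g x).det := (hgpos x).det_pos.ne'.isUnit
  have hH : ∀ y, (mpd j g y)ᵀ = mpd j g y := mpd_transpose hsymm j
  simp only [theta, mul_nonsing_inv_cancel_left _ _ hdet, transpose_sub, transpose_mul,
    transpose_nonsing_inv, hsymm, mpd_transpose hsymm, mpd_comm hg j k,
    Matrix.mul_assoc]
  rw [← mpd_comm hg j k, mpd_transpose hH]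

theorem minner_add_left {n d : ℕ} (a : Matrix (Fin d) (Fin d) ℝ) (U U' V : Fin n → Fin d → ℝ) :
    minner a (U + U') V = minner a U V + minner a U' V := by
  simp [minner, mulVec_add, Finset.sum_add_distrib]

theorem minner_neg_left {n d : ℕ} (a : Matrix (Fin d) (Fin d) ℝ) (U V : Fin n → Fin d → ℝ) :
    minner a (-U) V = -minner a U V := by
  simp [minner, mulVec_neg]

theorem minner_comm {n d : ℕ} {a : Matrix (Fin d) (Fin d) ℝ} (ha : aᵀ = a)
    (U V : Fin n → Fin d → ℝ) : minner a U V = minner a V U := by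
  refine Finset.sum_congr rfl fun k _ => ?_
  rw [dotProduct_comm, dotProduct_mulVec, ← mulVec_transpose, ha]

theorem minner_append {n0 n1 d : ℕ} (a : Matrix (Fin d) (Fin d) ℝ)
    (U : Fin (n0 + n1) → Fin d → ℝ) (V : Fin n0 → Fin d → ℝ) (W : Fin n1 → Fin d → ℝ) :
    minner a U (Fin.append V W) =
      minner a (fun k => U (Fin.castAdd n1 k)) V + minner a (fun k => U (Fin.natAdd n0 k)) W := by
  simp [minner, Fin.sum_univ_add]

/-- The block `Θ^g_{1,0} : M_{d,n1}(ℝ) → M_{d,n0}(ℝ)`. -/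
def Theta10 {n0 n1 d : ℕ} (g : (Fin (n0 + n1) → ℝ) → Matrix (Fin d) (Fin d) ℝ)
    (x : Fin (n0 + n1) → ℝ) (W : Fin n1 → Fin d → ℝ) : Fin n0 → Fin d → ℝ :=
  fun k => ∑ j, (theta g (Fin.natAdd n0 j) (Fin.castAdd n1 k) x).mulVec (W j)

/-- `Θ^g_{1,0}` is the adjoint of `Θ^g_{0,1}` for the inner products weighted by `g`. -/
theorem minner_Theta10 {n0 n1 d : ℕ} {g : (Fin (n0 + n1) → ℝ) → Matrix (Fin d) (Fin d) ℝ}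
    (hg : MatCD 2 g) (hgpos : ∀ y, (g y).PosDef) (x : Fin (n0 + n1) → ℝ)
    (V : Fin n0 → Fin d → ℝ) (W : Fin n1 → Fin d → ℝ) :
    minner (g x) (Theta10 g x W) V = minner (g x) (Theta01 g x V) W := by
  simp only [minner, Theta10, Theta01, mulVec_sum, sum_dotProduct, mulVec_mulVec]
  rw [Finset.sum_comm]
  refine Finset.sum_congr rfl fun j _ => Finset.sum_congr rfl fun k _ => ?_
  rw [dotProduct_comm, dotProduct_mulVec, ← mulVec_transpose, transpose_mul_theta hg hgpos]

theorem minner_ThetaOp_append {n0 n1 d : ℕ} (g : (Fin (n0 + n1) → ℝ) → Matrix (Fin d) (Fin d) ℝ)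
    (x : Fin (n0 + n1) → ℝ) (V : Fin n0 → Fin d → ℝ) (W : Fin n1 → Fin d → ℝ) :
    minner (g x) (ThetaOp g x (Fin.append V W)) (Fin.append V W) =
      minner (g x) (Theta00 g x V) V + minner (g x) (Theta10 g x W) V +
        (minner (g x) (Theta01 g x V) W + minner (g x) (Theta11 g x W) W) := by
  rw [minner_append, ← minner_add_left, ← minner_add_left]
  congr 2 <;> ext k i <;>
    simp [ThetaOp, Theta00, Theta01, Theta10, Theta11, Fin.sum_univ_add]

theorem Theta11_ofVec {n0 n1 d : ℕ} (g : (Fin (n0 + n1) → ℝ) → Matrix (Fin d) (Fin d) ℝ)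
    (x : Fin (n0 + n1) → ℝ) (w : Fin n1 × Fin d → ℝ) :
    Theta11 g x (ofVec w) = ofVec (Theta11Mat g x *ᵥ w) := by
  ext k i
  simp [Theta11, ofVec, Theta11Mat, mulVec, dotProduct, Fintype.sum_prod_type]

/-- **Block inequality for N-log-concave weights** (inverse form): if `Θ^g_{1,1}` is
invertible, then `⟨−Θ^g_{0,0} V₀, V₀⟩ ≥ ⟨(−Θ^g_{1,1})⁻¹ Θ^g_{0,1} V₀, Θ^g_{0,1} V₀⟩`. -/
theorem block_inverse_inequality (n0 n1 d : ℕ)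
    (g : (Fin (n0 + n1) → ℝ) → Matrix (Fin d) (Fin d) ℝ)
    (hg : MatCD 2 g) (hgpos : ∀ x, (g x).PosDef) (hglc : NLogConcave g)
    (x : Fin (n0 + n1) → ℝ) (hinv : IsUnit (Theta11Mat g x).det)
    (V0 : Fin n0 → Fin d → ℝ) :
    -minner (g x) (Theta00 g x V0) V0
      ≥ minner (g x) (ofVec ((-Theta11Mat g x)⁻¹.mulVec (toVec (Theta01 g x V0))))
          (Theta01 g x V0) := by
  set W := ofVec ((-Theta11Mat g x)⁻¹ *ᵥ toVec (Theta01 g x V0)) with hW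
  have hdet : IsUnit (-Theta11Mat g x).det :=
    (isUnit_iff_isUnit_det _).1 ((isUnit_iff_isUnit_det _).2 hinv).neg
  have hsolve : Theta11 g x W = -Theta01 g x V0 := by
    have h : -Theta11Mat g x *ᵥ ((-Theta11Mat g x)⁻¹ *ᵥ toVec (Theta01 g x V0)) =
        toVec (Theta01 g x V0) := by
      rw [mulVec_mulVec, mul_nonsing_inv _ hdet, one_mulVec]
    rw [neg_mulVec, neg_eq_iff_eq_neg] at h
    rw [hW, Theta11_ofVec, h]
    rfl
  have hsymm : (g x)ᵀ = g x := by
    simpa [conjTranspose_eq_transpose_of_trivial] using (hgpos x).isHermitian.eq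
  have hU := hglc x (Fin.append V0 W)
  rw [minner_ThetaOp_append, hsolve, minner_neg_left, minner_Theta10 hg hgpos] at hU
  rw [minner_comm hsymm W]
  linarith
end
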